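/- Let k, d, λ ≥ 1 be integers with d ≥ λ and k ≥ λ+1, and suppose α(d,λ) < 1 (the non-trivial range). Then m*(k,d,λ) ≤ (d−λ+1) + ⌊(2−α(d,λ))(k−1)⌋ = Z(k,d,λ). -/

import Mathlib

open Finset

noncomputable section

/-- Points of `ℝ^d`. -/
abbrev Pt (d : ℕ) : Type := Fin d → ℝ

/-- `L` is a complete Kneser `(d-λ)`-transversal of the finite point set `X` with respect
to `k`. -/
def IsCompleteKneserTransversal (k d lam : ℕ) (X : Finset (Pt d))
    (L : AffineSubspace ℝ (Pt d)) : Prop :=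
  Module.finrank ℝ L.direction = d - lam ∧
  (∃ T : Finset (Pt d), T ⊆ X ∧ T.card = d - lam + 1 ∧ (T : Set (Pt d)) ⊆ (L : Set (Pt d))) ∧
  ∀ Y : Finset (Pt d), Y ⊆ X → Y.card = k →
    ((convexHull ℝ (Y : Set (Pt d))) ∩ (L : Set (Pt d))).Nonempty

/-- `X` has a complete Kneser `(d-λ)`-transversal with respect to `k`. -/
def HasCKT (k d lam : ℕ) (X : Finset (Pt d)) : Prop :=
  ∃ L : AffineSubspace ℝ (Pt d), IsCompleteKneserTransversal k d lam X L

/-- The set of positive integers `n` such that every set of `n` points in `ℝ^d` has a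
complete Kneser `(d-λ)`-transversal with respect to `k`; `m*(k,d,λ)` is its maximum. -/
def mStarSet (k d lam : ℕ) : Set ℕ :=
  {n | 0 < n ∧ ∀ X : Finset (Pt d), X.card = n → HasCKT k d lam X}

/-- `α(d,λ) = (λ-1)/⌈d/2⌉` (note `⌈d/2⌉ = (d+1)/2` as naturals). -/
def alphaVal (d lam : ℕ) : ℝ := ((lam : ℝ) - 1) / (((d + 1) / 2 : ℕ) : ℝ)

/-- The upper bound `Z(k,d,λ) = (d-λ+1) + ⌊(2-α(d,λ))(k-1)⌋`, as an integer. -/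
def ZUpp (k d lam : ℕ) : ℤ :=
  ((d : ℤ) - (lam : ℤ) + 1) + ⌊(2 - alphaVal d lam) * ((k : ℝ) - 1)⌋

/-- A polynomial vanishing on `A` whose sign off `A` is prescribed on each of the intervals cut out
by `A`; its degree is twice the number of roots minus the number of sign changes. -/
lemma exists_polynomial_sign (S : ℕ → Prop) [DecidablePred S] (A : Finset ℝ) :
    ∃ p : Polynomial ℝ,
      p.natDegree + Nat.count (fun j => ¬(S j ↔ S (j + 1))) A.card ≤ 2 * A.card ∧
      (∀ t ∈ A, p.eval t = 0) ∧
      ∀ x, x ∉ A → (S (A.filter (· < x)).card → p.eval x < 0) ∧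
        (¬ S (A.filter (· < x)).card → 0 < p.eval x) := by
  induction A using Finset.induction_on_max with
  | empty =>
    by_cases h : S 0
    · exact ⟨Polynomial.C (-1), by simp, by simp, by simp [h]⟩
    · exact ⟨Polynomial.C 1, by simp, by simp, by simp [h]⟩
  | insert M A hM ih =>
    obtain ⟨p, hdeg, hroot, hsign⟩ := ih
    have hMA : M ∉ A := fun h => lt_irrefl _ (hM M h)
    have hlt : ∀ x < M, (insert M A).filter (· < x) = A.filter (· < x) := fun x hx => by
      rw [Finset.filter_insert, if_neg (not_lt.2 hx.le)]
    have hgt : ∀ x, M < x → (insert M A).filter (· < x) = insert M A ∧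
        A.filter (· < x) = A := fun x hx => by
      constructor
      · rw [Finset.filter_eq_self]
        intro a ha
        rcases Finset.mem_insert.1 ha with rfl | ha
        · exact hx
        · exact (hM a ha).trans hx
      · rw [Finset.filter_eq_self]
        exact fun a ha => (hM a ha).trans hx
    by_cases h : (S A.card ↔ S (A.card + 1))
    · refine ⟨p * (Polynomial.X - Polynomial.C M) ^ 2, ?_, ?_, ?_⟩
      · rw [Finset.card_insert_of_notMem hMA, Nat.count_succ, if_neg (not_not.2 h)]
        have := Polynomial.natDegree_mul_le (p := p) (q := (Polynomial.X - Polynomial.C M) ^ 2)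
        rw [Polynomial.natDegree_pow, Polynomial.natDegree_X_sub_C] at this
        omega
      · intro t ht
        rcases Finset.mem_insert.1 ht with rfl | ht
        · simp
        · simp [hroot t ht]
      · intro x hx
        rw [Finset.mem_insert, not_or] at hx
        have hpos : 0 < (x - M) ^ 2 := by have := sub_ne_zero.2 hx.1; positivity
        simp only [Polynomial.eval_mul, Polynomial.eval_pow, Polynomial.eval_sub,
          Polynomial.eval_X, Polynomial.eval_C, mul_pos_iff_of_pos_right hpos]
        have hs := hsign x hx.2
        rcases lt_or_gt_of_ne hx.1 with hxM | hxM
        · rw [hlt x hxM]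
          exact ⟨fun h' => mul_neg_of_neg_of_pos (hs.1 h') hpos, hs.2⟩
        · rw [(hgt x hxM).2] at hs
          rw [(hgt x hxM).1, Finset.card_insert_of_notMem hMA, ← h]
          exact ⟨fun h' => mul_neg_of_neg_of_pos (hs.1 h') hpos, hs.2⟩
    · refine ⟨p * (Polynomial.C M - Polynomial.X), ?_, ?_, ?_⟩
      · rw [Finset.card_insert_of_notMem hMA, Nat.count_succ, if_pos h]
        have := Polynomial.natDegree_mul_le (p := p) (q := Polynomial.C M - Polynomial.X)
        have h1 : (Polynomial.C M - Polynomial.X).natDegree ≤ 1 :=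
          (Polynomial.natDegree_sub_le _ _).trans (by simp)
        omega
      · intro t ht
        rcases Finset.mem_insert.1 ht with rfl | ht
        · simp
        · simp [hroot t ht]
      · intro x hx
        rw [Finset.mem_insert, not_or] at hx
        simp only [Polynomial.eval_mul, Polynomial.eval_sub, Polynomial.eval_X,
          Polynomial.eval_C]
        have hs := hsign x hx.2
        rcases lt_or_gt_of_ne hx.1 with hxM | hxM
        · have hpos : 0 < M - x := sub_pos.2 hxM
          rw [mul_pos_iff_of_pos_right hpos, hlt x hxM]
          exact ⟨fun h' => mul_neg_of_neg_of_pos (hs.1 h') hpos, hs.2⟩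
        · have hneg : M - x < 0 := sub_neg.2 hxM
          rw [(hgt x hxM).2] at hs
          rw [(hgt x hxM).1, Finset.card_insert_of_notMem hMA]
          constructor
          · intro h'
            exact mul_neg_of_pos_of_neg (hs.2 (by tauto)) hneg
          · intro h'
            exact mul_pos_of_neg_of_neg (hs.1 (by tauto)) hneg

/-- The `N`-periodic pattern marking the residues `0, 2, …, 2 * h - 2`. -/
def SparsePattern (N h i : ℕ) : Prop := i % N % 2 = 0 ∧ i % N < 2 * h

instance (N h : ℕ) : DecidablePred (SparsePattern N h) :=
  fun _ => inferInstanceAs (Decidable (_ ∧ _))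

lemma sparsePattern_periodic (N h : ℕ) : Function.Periodic (SparsePattern N h) N := by
  intro i
  simp [SparsePattern]

lemma count_shift_of_periodic {N : ℕ} {p : ℕ → Prop} [DecidablePred p]
    (hp : Function.Periodic p N) (s : ℕ) :
    Nat.count (fun i => p (s + i)) N = Nat.count p N := by
  have h1 := Nat.count_add p s N
  have h2 := Nat.filter_Ico_card_eq_of_periodic s N p hp
  rw [← h2, Nat.count_eq_card_filter_range, ← Finset.card_map (addLeftEmbedding s)]
  congr 1
  ext x
  simp only [Finset.mem_map, Finset.mem_filter, Finset.mem_range, addLeftEmbedding_apply,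
    Finset.mem_Ico]
  constructor
  · rintro ⟨a, ⟨ha, hpa⟩, rfl⟩
    exact ⟨by omega, hpa⟩
  · rintro ⟨hx, hpx⟩
    exact ⟨x - s, ⟨by omega, by rwa [Nat.add_sub_cancel' hx.1]⟩, by omega⟩

lemma count_sparsePattern_le {N h : ℕ} :
    Nat.count (SparsePattern N h) N ≤ h := by
  rw [Nat.count_eq_card_filter_range]
  calc _ ≤ ((Finset.range h).image (fun i => 2 * i)).card := by
        apply Finset.card_le_card
        intro x hx
        rw [Finset.mem_filter, Finset.mem_range] at hx
        unfold SparsePattern at hx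
        rw [Nat.mod_eq_of_lt hx.1] at hx
        exact Finset.mem_image.2 ⟨x / 2, Finset.mem_range.2 (by omega), by omega⟩
    _ ≤ h := by simpa using Finset.card_image_le (s := Finset.range h) (f := fun i => 2 * i)

lemma two_mul_le_count_sparsePattern_change {N h : ℕ} (hh : 1 ≤ h) (hN : 2 * h ≤ N) :
    2 * h ≤ Nat.count (fun i => ¬(SparsePattern N h i ↔ SparsePattern N h (i + 1))) N := by
  rw [Nat.count_eq_card_filter_range]
  calc 2 * h = (insert (N - 1) (Finset.range (2 * h - 1))).card := by
        rw [Finset.card_insert_of_notMem (by simp; omega), Finset.card_range]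
        omega
    _ ≤ _ := by
        apply Finset.card_le_card
        intro x hx
        simp only [Finset.mem_insert, Finset.mem_range] at hx
        rw [Finset.mem_filter, Finset.mem_range]
        unfold SparsePattern
        refine ⟨by omega, ?_⟩
        rcases hx with rfl | hx
        · rw [Nat.sub_add_cancel (by omega), Nat.mod_self,
            Nat.mod_eq_of_lt (by omega : N - 1 < N)]
          omega
        · rw [Nat.mod_eq_of_lt (by omega : x < N), Nat.mod_eq_of_lt (by omega : x + 1 < N)]
          omega

/-- Averaging over all shifts of the pattern. -/
lemma exists_shift_card_mul_le {ι : Type*} (B : Finset ι) (c : ι → ℕ) {N h : ℕ} (hN : 0 < N) :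
    ∃ s, N * (B.filter (fun x => SparsePattern N h (s + c x))).card ≤ B.card * h := by
  by_contra! hcon
  have h1 : ∑ s ∈ Finset.range N, (B.filter (fun x => SparsePattern N h (s + c x))).card
      ≤ B.card * h := by
    simp only [Finset.card_filter]
    rw [Finset.sum_comm]
    refine (Finset.sum_le_card_nsmul B _ h fun x _ => ?_)
    rw [← Finset.card_filter, ← Nat.count_eq_card_filter_range]
    simp only [add_comm _ (c x)]
    rw [count_shift_of_periodic (sparsePattern_periodic N h)]
    exact count_sparsePattern_le
  have h2 : ∑ s ∈ Finset.range N, B.card * h < ∑ s ∈ Finset.range N,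
      N * (B.filter (fun x => SparsePattern N h (s + c x))).card :=
    Finset.sum_lt_sum_of_nonempty (Finset.nonempty_range_iff.2 hN.ne') fun s _ => hcon s
  rw [Finset.sum_const, Finset.card_range, smul_eq_mul, ← Finset.mul_sum] at h2
  exact absurd (Nat.mul_le_mul_left N h1) (not_le.2 h2)

/-- The moment curve. -/
def momentCurve (d : ℕ) (x : ℝ) : Pt d := fun i => x ^ ((i : ℕ) + 1)

lemma momentCurve_injective {d : ℕ} (hd : 1 ≤ d) : Function.Injective (momentCurve d) := by
  intro x y h
  simpa [momentCurve] using congrFun h ⟨0, hd⟩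

lemma exists_affineMap_momentCurve {d : ℕ} (p : Polynomial ℝ) (hp : p.natDegree ≤ d) :
    ∃ f : Pt d →ᵃ[ℝ] ℝ, ∀ x, f (momentCurve d x) = p.eval x := by
  refine ⟨(∑ i : Fin d, p.coeff (i + 1) • LinearMap.proj (R := ℝ) (φ := fun _ => ℝ) i).toAffineMap
    + AffineMap.const ℝ (Pt d) (p.coeff 0), fun x => ?_⟩
  rw [Polynomial.eval_eq_sum_range' (Nat.lt_succ_of_le hp), Finset.sum_range_succ']
  simp [momentCurve, Finset.sum_range]

lemma affineIndependent_momentCurve {d : ℕ} (A : Finset ℝ) (hA : A.card ≤ d + 1) :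
    AffineIndependent ℝ (fun t : A => momentCurve d t) := by
  rw [affineIndependent_iff_of_fintype]
  intro w hw hv t₀
  set p : Polynomial ℝ := ∏ t ∈ A.erase t₀, (Polynomial.X - Polynomial.C t)
  have hp : p.natDegree ≤ d := by
    rw [Polynomial.natDegree_finsetProd_X_sub_C_eq_card, Finset.card_erase_of_mem t₀.2]
    omega
  obtain ⟨f, hf⟩ := exists_affineMap_momentCurve p hp
  have hsum : ∑ t : A, w t * p.eval (t : ℝ) = 0 := by
    rw [Finset.weightedVSub_eq_weightedVSubOfPoint_of_sum_eq_zero _ _ _ hw 0,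
      Finset.weightedVSubOfPoint_apply] at hv
    have := congrArg f.linear hv
    simp only [vsub_eq_sub, sub_zero, map_sum, map_smul, smul_eq_mul, map_zero] at this
    have hdec : ∀ y, f y = f.linear y + f 0 := fun y => by
      have := congrFun f.decomp y
      simpa using this
    calc _ = ∑ t : A, (w t * f.linear (momentCurve d t) + w t * f 0) :=
          Finset.sum_congr rfl fun t _ => by rw [← hf, hdec (momentCurve d t), mul_add]
      _ = 0 := by rw [Finset.sum_add_distrib, this, ← Finset.sum_mul, hw, zero_mul, zero_add]
  rw [Finset.sum_eq_single t₀] at hsum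
  · refine (mul_eq_zero.1 hsum).resolve_right ?_
    rw [Polynomial.eval_prod]
    refine Finset.prod_ne_zero_iff.2 ?_
    intro t ht
    simpa [sub_eq_zero] using (Finset.ne_of_mem_erase ht).symm
  · intro t _ ht
    rw [Polynomial.eval_prod, Finset.prod_eq_zero (i := (t : ℝ)), mul_zero]
    · exact Finset.mem_erase.2 ⟨fun h => ht (Subtype.ext h), t.2⟩
    · simp
  · simp

/-- Among the points `B` off `A` there are many on which a suitable polynomial of degree at most
`d` vanishing on `A` is positive. -/
lemma exists_polynomial_pos_many {d lam : ℕ} (hlam : 1 ≤ lam) (hdl : lam ≤ d)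
    (hα : lam ≤ (d + 1) / 2) (A B : Finset ℝ) (hA : A.card = d - lam + 1) (hAB : Disjoint A B) :
    ∃ p : Polynomial ℝ, p.natDegree ≤ d ∧ (∀ t ∈ A, p.eval t = 0) ∧
      B.card * ((d + 1) / 2) ≤
        (2 * ((d + 1) / 2) + 1 - lam) * (B.filter (fun x => 0 < p.eval x)).card := by
  set D := (d + 1) / 2 with hD
  set N := 2 * D + 1 - lam with hN
  set h := D + 1 - lam with hh
  obtain ⟨s, hs⟩ := exists_shift_card_mul_le B (fun x => (A.filter (· < x)).card) (N := N) (h := h)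
    (by omega)
  obtain ⟨p, hdeg, hroot, hsign⟩ := exists_polynomial_sign (fun i => SparsePattern N h (s + i)) A
  refine ⟨p, ?_, hroot, ?_⟩
  · have hper : Function.Periodic
        (fun i => ¬(SparsePattern N h i ↔ SparsePattern N h (i + 1))) N := by
      intro i
      simp only [add_right_comm i N 1, sparsePattern_periodic N h _]
    have hcount := count_shift_of_periodic hper s
    have hge := two_mul_le_count_sparsePattern_change (N := N) (h := h) (by omega) (by omega)
    rw [← hcount] at hge
    simp only [add_assoc] at hge
    rcases Nat.even_or_odd' d with ⟨e, he | he⟩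
    · have : A.card = N := by omega
      rw [this] at hdeg
      omega
    · have : N = A.card + 1 := by omega
      have hsucc := Nat.count_succ
        (fun j => ¬(SparsePattern N h (s + j) ↔ SparsePattern N h (s + (j + 1)))) A.card
      rw [← this] at hsucc
      split_ifs at hsucc <;> omega
  · have hsub : B.filter (fun x => ¬ 0 < p.eval x) ⊆
        B.filter (fun x => SparsePattern N h (s + (A.filter (· < x)).card)) := by
      intro x hx
      rw [Finset.mem_filter] at hx ⊢
      refine ⟨hx.1, ?_⟩
      by_contra hc
      exact hx.2 ((hsign x (Finset.disjoint_right.1 hAB hx.1)).2 hc)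
    have h1 := Finset.card_le_card hsub
    have h2 := Finset.card_filter_add_card_filter_not (s := B) (fun x => 0 < p.eval x)
    have h3 : N = D + h := by omega
    have h4 := (Nat.mul_le_mul_left N h1).trans hs
    nlinarith

/-- in the non-trivial range `α(d,λ) < 1`,
`m*(k,d,λ) ≤ (d-λ+1) + ⌊(2-α(d,λ))(k-1)⌋ = Z(k,d,λ)`. -/
theorem mStar_upper_bound (k d lam : ℕ) (hk : 1 ≤ k) (hd : 1 ≤ d) (hlam : 1 ≤ lam)
    (hdl : lam ≤ d) (hkl : lam + 1 ≤ k) (hα : alphaVal d lam < 1) :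
    ∀ n ∈ mStarSet k d lam, (n : ℤ) ≤ ZUpp k d lam := by
  rintro n ⟨-, hn⟩
  have hD : 0 < (d + 1) / 2 := by omega
  have hD' : (0 : ℝ) < ((d + 1) / 2 : ℕ) := by exact_mod_cast hD
  have hlamD : lam ≤ (d + 1) / 2 := by
    rw [alphaVal, div_lt_one hD', sub_lt_iff_lt_add] at hα
    have : lam < (d + 1) / 2 + 1 := by exact_mod_cast hα
    omega
  have hinj := momentCurve_injective hd
  set P : Finset ℝ := (Finset.range n).image (fun i : ℕ => (i : ℝ)) with hP
  have hPcard : P.card = n := by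
    rw [hP, Finset.card_image_of_injective _ Nat.cast_injective, Finset.card_range]
  obtain ⟨L, hL, ⟨T, hTX, hTcard, hTL⟩, hY⟩ := hn (P.image (momentCurve d))
    (by rw [Finset.card_image_of_injective _ hinj, hPcard])
  obtain ⟨A, hAP, rfl⟩ := Finset.subset_image_iff.1 hTX
  rw [Finset.card_image_of_injective _ hinj] at hTcard
  obtain ⟨p, hpd, hp0, hpos⟩ := exists_polynomial_pos_many hlam hdl hlamD A (P \ A) hTcard
    Finset.disjoint_sdiff
  obtain ⟨f, hf⟩ := exists_affineMap_momentCurve p hpd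
  have hspan : affineSpan ℝ (Set.range fun t : A => momentCurve d t) = L := by
    refine (affineIndependent_momentCurve A (by omega)).affineSpan_eq_of_le_of_card_eq_finrank_add_one
      ?_ (by rw [Fintype.card_coe, hTcard, hL])
    rw [affineSpan_le]
    rintro _ ⟨t, rfl⟩
    exact hTL (Finset.mem_coe.2 (Finset.mem_image_of_mem _ t.2))
  have hfL : ∀ y ∈ L, f y = 0 := by
    intro y hy
    rw [← hspan] at hy
    refine affineSpan_induction (p := fun y => f y = 0) hy ?_ ?_
    · rintro _ ⟨t, rfl⟩
      rw [hf, hp0 t t.2]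
    · intro c u v w hu hv hw
      rw [f.map_vadd, map_smul, f.linearMap_vsub, hu, hv, hw]
      simp
  have hlt : ((P \ A).filter (fun x => 0 < p.eval x)).card < k := by
    by_contra! hge
    obtain ⟨Y, hYsub, hYcard⟩ := Finset.exists_subset_card_eq hge
    obtain ⟨y, hyY, hyL⟩ := hY (Y.image (momentCurve d))
      (Finset.image_subset_image (hYsub.trans ((Finset.filter_subset _ _).trans
        Finset.sdiff_subset))) (by rw [Finset.card_image_of_injective _ hinj, hYcard])
    have hsub : convexHull ℝ ((Y.image (momentCurve d) : Finset (Pt d)) : Set (Pt d)) ⊆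
        f ⁻¹' Set.Ioi 0 := by
      refine convexHull_min ?_ ((convex_Ioi 0).affine_preimage f)
      intro z hz
      obtain ⟨x, hx, rfl⟩ := Finset.mem_image.1 (Finset.mem_coe.1 hz)
      rw [Set.mem_preimage, hf]
      exact (Finset.mem_filter.1 (hYsub hx)).2
    exact (ne_of_gt (hsub hyY : 0 < f y)) (hfL y hyL)
  have hcard : (P \ A).card + (d - lam + 1) = n := by
    rw [← hTcard, Finset.card_sdiff_add_card_eq_card hAP, hPcard]
  have hle : (P \ A).card * ((d + 1) / 2) ≤ (2 * ((d + 1) / 2) + 1 - lam) * (k - 1) :=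
    hpos.trans (Nat.mul_le_mul_left _ (by omega))
  have hfloor : ((P \ A).card : ℤ) ≤ ⌊(2 - alphaVal d lam) * ((k : ℝ) - 1)⌋ := by
    rw [Int.le_floor]
    have hleR : ((P \ A).card : ℝ) * ((d + 1) / 2 : ℕ) ≤
        (2 * ((d + 1) / 2 : ℕ) + 1 - lam) * ((k : ℝ) - 1) := by
      have := (Nat.cast_le (α := ℝ)).2 hle
      rw [Nat.cast_mul, Nat.cast_mul, Nat.cast_sub (by omega), Nat.cast_sub hk] at this
      push_cast at this ⊢
      exact this
    rw [Int.cast_natCast, ← mul_le_mul_iff_left₀ hD']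
    refine hleR.trans (le_of_eq ?_)
    rw [alphaVal]
    field_simp
    ring
  rw [ZUpp]
  omega
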